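/- arXiv:1805.00593 — 2 statements merged into one kernel-verified Lean document; each statement's English description precedes it below -/
import Mathlib

section
/- (Proposition 3.2.) Let p ∈ ℝ³, η > 0, T > η, τ > 0, and let x ∈ ℝ³ satisfy 0 < |x − p| < T − η. Then (1/(4π)) ∫_{{y : T−η < |y−p| < T+η}} ( e^{−τ|x−y|}/|x−y| ) · ( τ v(y,T) − ∂_t v(y,T) ) dy = (1/τ²)·( 𝓗₊(τ;T,η) + 𝓗₋(τ;T,η) )·sinh(τ|x − p|)/|x − p|, where ∂_t v(y,T) denotes the derivative of s ↦ v(y,s) at s = T. -/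
open MeasureTheory Real

noncomputable def PsiB (p : EuclideanSpace ℝ (Fin 3)) (η : ℝ)
    (x : EuclideanSpace ℝ (Fin 3)) : ℝ :=
  if ‖x - p‖ < η then η - ‖x - p‖ else 0

/-- `v(x,t) = (t/(4π)) ∫_{S²} Ψ_B(x + tω) dσ(ω)`, where `σ = volume.toSphere` is the
surface measure on the unit sphere in `ℝ³` (total mass `4π`). -/
noncomputable def waveV (p : EuclideanSpace ℝ (Fin 3)) (η : ℝ)
    (x : EuclideanSpace ℝ (Fin 3)) (t : ℝ) : ℝ :=
  (t / (4 * π)) *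
    ∫ ω : Metric.sphere (0 : EuclideanSpace ℝ (Fin 3)) 1,
      PsiB p η (x + t • (ω : EuclideanSpace ℝ (Fin 3)))
      ∂((volume : Measure (EuclideanSpace ℝ (Fin 3))).toSphere)
noncomputable def Hm1 (τ R₁ R₂ : ℝ) : ℝ := Real.exp (-τ * R₁) - Real.exp (-τ * R₂)

noncomputable def H0 (τ R₁ R₂ : ℝ) : ℝ :=
  (R₁ + 1 / τ) * Real.exp (-τ * R₁) - (R₂ + 1 / τ) * Real.exp (-τ * R₂)

noncomputable def H1 (τ R₁ R₂ : ℝ) : ℝ :=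
  (R₁ ^ 2 + 2 * R₁ / τ + 2 / τ ^ 2) * Real.exp (-τ * R₁)
    - (R₂ ^ 2 + 2 * R₂ / τ + 2 / τ ^ 2) * Real.exp (-τ * R₂)

noncomputable def H2 (τ R₁ R₂ : ℝ) : ℝ :=
  (R₁ ^ 3 + 3 * R₁ ^ 2 / τ + 6 * R₁ / τ ^ 2 + 6 / τ ^ 3) * Real.exp (-τ * R₁)
    - (R₂ ^ 3 + 3 * R₂ ^ 2 / τ + 6 * R₂ / τ ^ 2 + 6 / τ ^ 3) * Real.exp (-τ * R₂)

/-- `𝓗₊(τ;T,η)` from (3.5). -/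
noncomputable def Hplus (τ T η : ℝ) : ℝ :=
  ((τ / 12) * (η - 2 * T) * (η + T) ^ 2 + (T / 2) * (η + T)) * Hm1 τ T (T + η)
    + ((τ / 2) * T * (η + T) - (η + 2 * T) / 2) * H0 τ T (T + η)
    + (-(τ / 4) * (η + 2 * T) + 1 / 2) * H1 τ T (T + η)
    + (τ / 6) * H2 τ T (T + η)

/-- `𝓗₋(τ;T,η)` from (3.6). -/
noncomputable def Hminus (τ T η : ℝ) : ℝ :=
  ((τ / 12) * (η + 2 * T) * (η - T) ^ 2 + (T / 2) * (η - T)) * Hm1 τ (T - η) T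
    + ((τ / 2) * T * (η - T) - (η - 2 * T) / 2) * H0 τ (T - η) T
    + (-(τ / 4) * (η - 2 * T) - 1 / 2) * H1 τ (T - η) T
    - (τ / 6) * H2 τ (T - η) T


lemma A1 (h : ℝ → ENNReal) (hh : Measurable h) :
    ∫⁻ w : ℝ × ℝ, h (√(w.1 ^ 2 + w.2 ^ 2)) =
      ENNReal.ofReal (2 * π) * ∫⁻ s in Set.Ioi (0 : ℝ), ENNReal.ofReal s * h s := by
  rw [← lintegral_comp_polarCoord_symm]
  have h1 : ∀ q ∈ polarCoord.target, ENNReal.ofReal q.1 • h (√((polarCoord.symm q).1 ^ 2 + (polarCoord.symm q).2 ^ 2))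
      = ENNReal.ofReal q.1 * h q.1 := by
    rintro ⟨r, θ⟩ hq
    have hr : 0 < r := hq.1
    have : √((polarCoord.symm (r, θ)).1 ^ 2 + (polarCoord.symm (r, θ)).2 ^ 2) = r := by
      rw [polarCoord_symm_apply]
      have : (r * cos θ) ^ 2 + (r * sin θ) ^ 2 = r ^ 2 := by
        have := sin_sq_add_cos_sq θ
        linear_combination r ^ 2 * this
      simp only [this]
      exact Real.sqrt_sq hr.le
    rw [this, smul_eq_mul]
  rw [setLIntegral_congr_fun polarCoord.open_target.measurableSet h1]
  have h2 : polarCoord.target = Set.Ioi (0 : ℝ) ×ˢ Set.Ioo (-π) π := rfl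
  rw [h2, Measure.volume_eq_prod, ← Measure.prod_restrict, lintegral_prod _ (by fun_prop)]
  simp only [lintegral_const, Measure.restrict_apply MeasurableSet.univ, Set.univ_inter, Real.volume_Ioo]
  rw [lintegral_mul_const _ (by fun_prop), mul_comm]
  congr 2
  ring

lemma A2 (z : ℝ) (F : ℝ → ENNReal) :
    ∫⁻ s in Set.Ioi (0 : ℝ), ENNReal.ofReal s * F (√(z ^ 2 + s ^ 2)) =
      ∫⁻ R in Set.Ioi |z|, ENNReal.ofReal R * F R := by
  have him : (fun s : ℝ => √(z ^ 2 + s ^ 2)) '' Set.Ioi 0 = Set.Ioi |z| := by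
    ext R
    simp only [Set.mem_image, Set.mem_Ioi]
    constructor
    · rintro ⟨s, hs, rfl⟩
      rw [← Real.sqrt_sq_eq_abs]
      exact Real.sqrt_lt_sqrt (sq_nonneg z) (by nlinarith)
    · intro hR
      have h0 : 0 < R := lt_of_le_of_lt (abs_nonneg z) hR
      have h1 : 0 < R ^ 2 - z ^ 2 := by
        rw [← sq_abs z]; nlinarith [abs_nonneg z]
      refine ⟨√(R ^ 2 - z ^ 2), Real.sqrt_pos.2 h1, ?_⟩
      rw [Real.sq_sqrt h1.le]
      rw [add_sub_cancel, Real.sqrt_sq h0.le]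
  rw [← him, lintegral_image_eq_lintegral_abs_deriv_mul (f' := fun s => s / √(z ^ 2 + s ^ 2)) measurableSet_Ioi]
  · refine setLIntegral_congr_fun measurableSet_Ioi fun s hs => ?_
    have hs : 0 < s := hs
    have h1 : 0 < √(z ^ 2 + s ^ 2) := Real.sqrt_pos.2 (by positivity)
    rw [← mul_assoc, ← ENNReal.ofReal_mul (abs_nonneg _), abs_of_pos (by positivity), div_mul_cancel₀ _ h1.ne']
  · intro s hs
    have hs : 0 < s := hs
    have h1 : 0 < √(z ^ 2 + s ^ 2) := Real.sqrt_pos.2 (by positivity)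
    have h2 : HasDerivAt (fun s : ℝ => z ^ 2 + s ^ 2) (2 * s) s := by
      simpa using (hasDerivAt_pow 2 s).const_add (z ^ 2)
    have := (h2.sqrt (by positivity)).hasDerivWithinAt (s := Set.Ioi 0)
    rwa [mul_div_mul_left s _ two_ne_zero] at this
  · intro a ha b hb hab
    have ha : 0 < a := ha
    have hb : 0 < b := hb
    simp only at hab
    rw [Real.sqrt_inj (by positivity) (by positivity)] at hab
    nlinarith

lemma A3 (F : ℝ × ℝ → ENNReal) (hF : Measurable F) :
    ∫⁻ y : EuclideanSpace ℝ (Fin 3), F (y 0, ‖y‖) =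
      ENNReal.ofReal (2 * π) * ∫⁻ R in Set.Ioi (0 : ℝ), ENNReal.ofReal R * ∫⁻ z in Set.Ioo (-R) R, F (z, R) := by
  have e1 : ∫⁻ y : EuclideanSpace ℝ (Fin 3), F (y 0, ‖y‖) =
      ∫⁻ q : ℝ × (ℝ × ℝ), F (q.1, √(q.1 ^ 2 + (√(q.2.1 ^ 2 + q.2.2 ^ 2)) ^ 2)) := by
    have m1 := PiLp.volume_preserving_ofLp (Fin 3)
    have m2 := volume_preserving_piFinSuccAbove (fun _ : Fin 3 => ℝ) 0
    have m3 := (MeasurePreserving.id (volume : Measure ℝ)).prod (volume_preserving_finTwoArrow ℝ)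
    have m := (m3.comp m2).comp m1
    rw [Measure.volume_eq_prod ℝ (ℝ × ℝ), ← m.lintegral_comp (by fun_prop)]
    refine lintegral_congr fun y => ?_
    congr 2
    rw [EuclideanSpace.norm_eq, Real.sq_sqrt (by positivity)]
    simp [Fin.sum_univ_succ, MeasurableEquiv.piFinSuccAbove, MeasurableEquiv.finTwoArrow, Fin.tail]
  rw [e1, Measure.volume_eq_prod ℝ (ℝ × ℝ), lintegral_prod _ (by fun_prop)]
  simp only
  have e2 : ∀ z : ℝ, ∫⁻ w : ℝ × ℝ, F (z, √(z ^ 2 + (√(w.1 ^ 2 + w.2 ^ 2)) ^ 2)) =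
      ENNReal.ofReal (2 * π) * ∫⁻ R in Set.Ioi |z|, ENNReal.ofReal R * F (z, R) := by
    intro z
    rw [A1 (fun s => F (z, √(z ^ 2 + s ^ 2))) (by fun_prop), A2 z (fun R => F (z, R))]
  simp_rw [e2]
  have e3 : ∀ z : ℝ, ∫⁻ R in Set.Ioi |z|, ENNReal.ofReal R * F (z, R) =
      ∫⁻ R : ℝ, {q : ℝ × ℝ | |q.1| < q.2}.indicator (fun q => ENNReal.ofReal q.2 * F q) (z, R) := by
    intro z
    rw [← lintegral_indicator measurableSet_Ioi]
    refine lintegral_congr fun R => ?_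
    simp [Set.indicator]
  have hS : MeasurableSet {q : ℝ × ℝ | |q.1| < q.2} := measurableSet_lt (by fun_prop) (by fun_prop)
  have hm : Measurable (fun q : ℝ × ℝ => {q : ℝ × ℝ | |q.1| < q.2}.indicator (fun q => ENNReal.ofReal q.2 * F q) q) :=
    Measurable.indicator (by fun_prop) hS
  simp_rw [e3]
  rw [lintegral_const_mul _ (by exact hm.lintegral_prod_right'), lintegral_lintegral_swap (by exact hm.aemeasurable)]
  congr 1
  rw [← lintegral_indicator measurableSet_Ioi]
  refine lintegral_congr fun R => ?_
  by_cases hR : 0 < R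
  · rw [Set.indicator_of_mem (by exact hR), ← lintegral_const_mul _ (by fun_prop),
      ← lintegral_indicator measurableSet_Ioo]
    refine lintegral_congr fun z => ?_
    simp [Set.indicator, abs_lt]
  · rw [Set.indicator_of_notMem (by exact hR)]
    rw [lintegral_eq_zero_iff (by fun_prop)]
    filter_upwards with z
    have : ¬ |z| < R := fun h => hR (lt_of_le_of_lt (abs_nonneg z) h)
    simp [this]

lemma A4 (e : EuclideanSpace ℝ (Fin 3)) (he : ‖e‖ = 1) (F : ℝ × ℝ → ENNReal) (hF : Measurable F) :
    ∫⁻ y : EuclideanSpace ℝ (Fin 3), F (inner ℝ e y, ‖y‖) =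
      ENNReal.ofReal (2 * π) * ∫⁻ R in Set.Ioi (0 : ℝ), ENNReal.ofReal R * ∫⁻ z in Set.Ioo (-R) R, F (z, R) := by
  obtain ⟨b, hb⟩ := Orthonormal.exists_orthonormalBasis_extension_of_card_eq (𝕜 := ℝ)
    (E := EuclideanSpace ℝ (Fin 3)) (ι := Fin 3) (by simp) (v := fun _ => e) (s := {0})
    (by
      constructor
      · intro i; simpa using he
      · intro i j hij
        exact absurd (Subsingleton.elim i j) hij)
  have hb0 : b 0 = e := hb 0 rfl
  rw [← A3 F hF, ← b.measurePreserving_repr.lintegral_comp (f := fun y => F (y 0, ‖y‖)) (by fun_prop)]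
  refine lintegral_congr fun y => ?_
  rw [b.repr_apply_apply, hb0, LinearIsometryEquiv.norm_map]

open scoped Pointwise in
lemma archimedes (e : EuclideanSpace ℝ (Fin 3)) (he : ‖e‖ = 1) :
    MeasurePreserving (fun ω : Metric.sphere (0 : EuclideanSpace ℝ (Fin 3)) 1 => inner ℝ e (ω : EuclideanSpace ℝ (Fin 3)))
      ((volume : Measure (EuclideanSpace ℝ (Fin 3))).toSphere)
      (ENNReal.ofReal (2 * π) • volume.restrict (Set.Ioo (-1) 1)) := by
  refine ⟨by fun_prop, ?_⟩
  ext A hA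
  rw [Measure.map_apply (by fun_prop) hA, Measure.toSphere_apply' _ (by measurability)]
  have hset : Set.Ioo (0:ℝ) 1 • (Subtype.val '' ((fun ω : Metric.sphere (0 : EuclideanSpace ℝ (Fin 3)) 1 => inner ℝ e (ω : EuclideanSpace ℝ (Fin 3))) ⁻¹' A))
      = (fun y : EuclideanSpace ℝ (Fin 3) => ((inner ℝ e y, ‖y‖) : ℝ × ℝ)) ⁻¹' {q : ℝ × ℝ | 0 < q.2 ∧ q.2 < 1 ∧ q.1 / q.2 ∈ A} := by
    ext y
    simp only [Set.mem_smul, Set.mem_image, Set.mem_preimage, Set.mem_ofPred_eq]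
    constructor
    · rintro ⟨r, hr, _, ⟨ω, hω, rfl⟩, rfl⟩
      have h1 : ‖(ω : EuclideanSpace ℝ (Fin 3))‖ = 1 := by simp
      rw [norm_smul, h1, inner_smul_right, Real.norm_of_nonneg hr.1.le, mul_one, mul_div_cancel_left₀ _ hr.1.ne']
      exact ⟨hr.1, hr.2, hω⟩
    · rintro ⟨h0, h1, h2⟩
      refine ⟨‖y‖, ⟨h0, h1⟩, ‖y‖⁻¹ • y, ⟨⟨‖y‖⁻¹ • y, ?_⟩, ?_, rfl⟩, ?_⟩
      · simp [norm_smul, h0.ne']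
      · simpa [inner_smul_right, div_eq_inv_mul] using h2
      · rw [smul_smul, mul_inv_cancel₀ h0.ne', one_smul]
  have hms : MeasurableSet {q : ℝ × ℝ | 0 < q.2 ∧ q.2 < 1 ∧ q.1 / q.2 ∈ A} := by
    have h3 : MeasurableSet ((fun q : ℝ × ℝ => q.1 / q.2) ⁻¹' A) := (by fun_prop : Measurable (fun q : ℝ × ℝ => q.1 / q.2)) hA
    have h4 : MeasurableSet {q : ℝ × ℝ | 0 < q.2} := measurableSet_lt (by fun_prop) (by fun_prop)
    have h5 : MeasurableSet {q : ℝ × ℝ | q.2 < 1} := measurableSet_lt (by fun_prop) (by fun_prop)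
    exact h4.inter (h5.inter h3)
  rw [hset, ← lintegral_indicator_one (hms.preimage (by fun_prop))]
  have := A4 e he ({q : ℝ × ℝ | 0 < q.2 ∧ q.2 < 1 ∧ q.1 / q.2 ∈ A}.indicator 1) (measurable_one.indicator hms)
  rw [show (∫⁻ a, ((fun y : EuclideanSpace ℝ (Fin 3) => ((inner ℝ e y, ‖y‖) : ℝ × ℝ)) ⁻¹' {q : ℝ × ℝ | 0 < q.2 ∧ q.2 < 1 ∧ q.1 / q.2 ∈ A}).indicator 1 a)
    = ∫⁻ y : EuclideanSpace ℝ (Fin 3), ({q : ℝ × ℝ | 0 < q.2 ∧ q.2 < 1 ∧ q.1 / q.2 ∈ A}.indicator (1 : ℝ × ℝ → ENNReal)) (inner ℝ e y, ‖y‖) from rfl, this]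
  have hin : ∀ R ∈ Set.Ioi (0:ℝ), ENNReal.ofReal R * ∫⁻ z in Set.Ioo (-R) R, ({q : ℝ × ℝ | 0 < q.2 ∧ q.2 < 1 ∧ q.1 / q.2 ∈ A}.indicator (1 : ℝ × ℝ → ENNReal)) (z, R)
      = (Set.Iio 1).indicator (fun R => ENNReal.ofReal (R ^ 2) * volume (A ∩ Set.Ioo (-1) 1)) R := by
    intro R hR
    have hR : 0 < R := hR
    by_cases hR1 : R < 1
    · rw [Set.indicator_of_mem (by exact hR1)]
      have : ∀ z, ({q : ℝ × ℝ | 0 < q.2 ∧ q.2 < 1 ∧ q.1 / q.2 ∈ A}.indicator (1 : ℝ × ℝ → ENNReal)) (z, R)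
          = ((fun z => R⁻¹ * z) ⁻¹' A).indicator 1 z := by
        intro z
        by_cases hz : R⁻¹ * z ∈ A <;> simp [Set.indicator, hR, hR1, div_eq_inv_mul, hz]
      simp_rw [this]
      have hpre : MeasurableSet ((fun z => R⁻¹ * z) ⁻¹' A) := hA.preimage (by fun_prop)
      rw [lintegral_indicator_one hpre, Measure.restrict_apply hpre]
      have h5 : (fun z => R⁻¹ * z) ⁻¹' A ∩ Set.Ioo (-R) R = (fun z => R⁻¹ * z) ⁻¹' (A ∩ Set.Ioo (-1) 1) := by
        ext z
        simp only [Set.mem_inter_iff, Set.mem_preimage, Set.mem_Ioo]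
        rw [← div_eq_inv_mul, lt_div_iff₀ hR, div_lt_iff₀ hR]
        simp
      rw [h5, Real.volume_preimage_mul_left (by positivity), inv_inv, abs_of_pos hR, ← mul_assoc, ← ENNReal.ofReal_mul hR.le, sq]
    · rw [Set.indicator_of_notMem (by exact hR1)]
      have : ∀ z, ({q : ℝ × ℝ | 0 < q.2 ∧ q.2 < 1 ∧ q.1 / q.2 ∈ A}.indicator (1 : ℝ × ℝ → ENNReal)) (z, R) = 0 := by
        intro z; simp [Set.indicator, hR1]
      simp [this]
  rw [setLIntegral_congr_fun measurableSet_Ioi hin, lintegral_indicator measurableSet_Iio, Measure.restrict_restrict measurableSet_Iio,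
    lintegral_mul_const _ (by fun_prop)]
  have h6 : ∫⁻ R in Set.Iio 1 ∩ Set.Ioi (0:ℝ), ENNReal.ofReal (R ^ 2) = ENNReal.ofReal (1/3) := by
    rw [Set.inter_comm, Set.Ioi_inter_Iio, restrict_Ioo_eq_restrict_Ioc, ← ofReal_integral_eq_lintegral_ofReal, ← intervalIntegral.integral_of_le zero_le_one]
    · norm_num
    · exact (intervalIntegral.intervalIntegrable_pow 2).1
    · filter_upwards with x; positivity
  rw [h6]
  simp only [Measure.smul_apply, Measure.restrict_apply hA, smul_eq_mul, finrank_euclideanSpace, Fintype.card_fin]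
  rw [← mul_assoc, ← mul_assoc]
  congr 1
  rw [show ((3:ℕ) : ENNReal) = ENNReal.ofReal 3 by simp, ← ENNReal.ofReal_mul (by norm_num), ← ENNReal.ofReal_mul (by positivity)]
  congr 1
  ring

lemma subst_c (a b : ℝ) (ha : 0 < a) (hb : 0 < b) (f : ℝ → ℝ) (hf : ContinuousOn f (Set.Icc |a - b| (a + b))) :
    (∫ c in (-1:ℝ)..1, f (√(a ^ 2 + b ^ 2 + 2 * a * b * c))) = (1 / (a * b)) * ∫ s in |a - b|..(a + b), f s * s := by
  have hab : |a - b| ≤ a + b := by rw [abs_le]; constructor <;> linarith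
  have hu : Set.uIcc |a - b| (a + b) = Set.Icc |a - b| (a + b) := Set.uIcc_of_le hab
  have key := intervalIntegral.integral_comp_mul_deriv'' (a := |a - b|) (b := a + b)
    (f := fun s => (s ^ 2 - a ^ 2 - b ^ 2) / (2 * a * b)) (f' := fun s => s / (a * b))
    (g := fun c => f (√(a ^ 2 + b ^ 2 + 2 * a * b * c)))
    (by fun_prop)
    (by
      intro s _
      have h2 : HasDerivAt (fun s : ℝ => (s ^ 2 - a ^ 2 - b ^ 2) / (2 * a * b)) (2 * s / (2 * a * b)) s := by
        have := (((hasDerivAt_pow 2 s).sub_const (a ^ 2)).sub_const (b ^ 2)).div_const (2 * a * b)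
        simpa using this
      have h3 : 2 * s / (2 * a * b) = s / (a * b) := by rw [mul_assoc, mul_div_mul_left _ _ two_ne_zero]
      rw [h3] at h2
      exact h2.hasDerivWithinAt)
    (by fun_prop)
    (by
      refine hf.comp (by fun_prop) ?_
      rintro _ ⟨s, hs, rfl⟩
      rw [hu] at hs
      have h0 : 0 ≤ s := (abs_nonneg _).trans hs.1
      have : a ^ 2 + b ^ 2 + 2 * a * b * ((s ^ 2 - a ^ 2 - b ^ 2) / (2 * a * b)) = s ^ 2 := by
        field_simp; ring
      simp only [this]
      rwa [Real.sqrt_sq h0])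
  have e1 : (|a - b| ^ 2 - a ^ 2 - b ^ 2) / (2 * a * b) = -1 := by
    rw [sq_abs]; field_simp; ring
  have e2 : ((a + b) ^ 2 - a ^ 2 - b ^ 2) / (2 * a * b) = 1 := by
    field_simp; ring
  simp only [e1, e2] at key
  rw [← key, ← intervalIntegral.integral_const_mul]
  refine intervalIntegral.integral_congr fun s hs => ?_
  rw [hu] at hs
  have h0 : 0 ≤ s := (abs_nonneg _).trans hs.1
  have : a ^ 2 + b ^ 2 + 2 * a * b * ((s ^ 2 - a ^ 2 - b ^ 2) / (2 * a * b)) = s ^ 2 := by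
    field_simp; ring
  simp only [Function.comp, this]
  rw [Real.sqrt_sq h0]
  ring

lemma sphere_int (ξ : EuclideanSpace ℝ (Fin 3)) (hξ : 0 < ‖ξ‖) (r : ℝ) (hr : 0 < r) (f : ℝ → ℝ)
    (hf : ContinuousOn f (Set.Icc |‖ξ‖ - r| (‖ξ‖ + r))) :
    ∫ ω : Metric.sphere (0 : EuclideanSpace ℝ (Fin 3)) 1, f ‖ξ + r • (ω : EuclideanSpace ℝ (Fin 3))‖
      ∂((volume : Measure (EuclideanSpace ℝ (Fin 3))).toSphere) =
    (2 * π) * ((1 / (‖ξ‖ * r)) * ∫ s in |‖ξ‖ - r|..(‖ξ‖ + r), f s * s) := by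
  set a := ‖ξ‖ with ha
  have he : ‖a⁻¹ • ξ‖ = 1 := by rw [norm_smul, norm_inv, norm_norm, ← ha, inv_mul_cancel₀ hξ.ne']
  have hA := archimedes (a⁻¹ • ξ) he
  rw [← subst_c a r hξ hr f hf]
  have e1 : ∀ ω : Metric.sphere (0 : EuclideanSpace ℝ (Fin 3)) 1, f ‖ξ + r • (ω : EuclideanSpace ℝ (Fin 3))‖ =
      (fun c => f (√(a ^ 2 + r ^ 2 + 2 * a * r * c))) (inner ℝ (a⁻¹ • ξ) (ω : EuclideanSpace ℝ (Fin 3))) := by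
    intro ω
    have h1 : ‖(ω : EuclideanSpace ℝ (Fin 3))‖ = 1 := by simp
    have h2 : ‖ξ + r • (ω : EuclideanSpace ℝ (Fin 3))‖ ^ 2 = a ^ 2 + r ^ 2 + 2 * a * r * inner ℝ (a⁻¹ • ξ) (ω : EuclideanSpace ℝ (Fin 3)) := by
      rw [norm_add_sq_real, norm_smul, h1, inner_smul_right, real_inner_smul_left, Real.norm_of_nonneg hr.le, ← ha]
      field_simp
      ring
    simp only
    rw [← h2, Real.sqrt_sq (norm_nonneg _)]
  simp_rw [e1]
  rw [← integral_map (f := fun c => f (√(a ^ 2 + r ^ 2 + 2 * a * r * c))) hA.measurable.aemeasurable, hA.map_eq, integral_smul_measure, ENNReal.toReal_ofReal (by positivity),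
    intervalIntegral.integral_of_le (by norm_num), restrict_Ioo_eq_restrict_Ioc, smul_eq_mul]
  rw [hA.map_eq]
  refine AEStronglyMeasurable.smul_measure ?_ _
  refine ContinuousOn.aestronglyMeasurable ?_ measurableSet_Ioo
  refine hf.comp (by fun_prop) ?_
  intro c hc
  have hp : 0 < a * r := by positivity
  constructor
  · apply Real.abs_le_sqrt
    nlinarith [hc.1]
  · rw [Real.sqrt_le_left (by positivity)]
    nlinarith [hc.2]

lemma polar_int (f : EuclideanSpace ℝ (Fin 3) → ℝ) (hf : Integrable f) :
    ∫ y, f y = ∫ r in Set.Ioi (0:ℝ), r ^ 2 * ∫ ω : Metric.sphere (0 : EuclideanSpace ℝ (Fin 3)) 1,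
      f (r • (ω : EuclideanSpace ℝ (Fin 3))) ∂((volume : Measure (EuclideanSpace ℝ (Fin 3))).toSphere) := by
  have hmp := (volume : Measure (EuclideanSpace ℝ (Fin 3))).measurePreserving_homeomorphUnitSphereProd
  have hemb := (homeomorphUnitSphereProd (EuclideanSpace ℝ (Fin 3))).measurableEmbedding
  have hcomp : ∀ x : ({0}ᶜ : Set (EuclideanSpace ℝ (Fin 3))),
      (fun q : Metric.sphere (0 : EuclideanSpace ℝ (Fin 3)) 1 × Set.Ioi (0:ℝ) => f ((q.2 : ℝ) • (q.1 : EuclideanSpace ℝ (Fin 3))))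
        (homeomorphUnitSphereProd _ x) = f x := by
    intro x
    have hx : ‖(x : EuclideanSpace ℝ (Fin 3))‖ ≠ 0 := norm_ne_zero_iff.2 x.2
    simp [smul_smul, hx]
  have h1 : ∫ y, f y = ∫ x : ({0}ᶜ : Set (EuclideanSpace ℝ (Fin 3))), f x ∂(volume.comap Subtype.val) := by
    rw [integral_subtype_comap (measurableSet_singleton _).compl f, restrict_compl_singleton]
  have hint : Integrable (fun q : Metric.sphere (0 : EuclideanSpace ℝ (Fin 3)) 1 × Set.Ioi (0:ℝ) => f ((q.2 : ℝ) • (q.1 : EuclideanSpace ℝ (Fin 3))))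
      ((volume : Measure (EuclideanSpace ℝ (Fin 3))).toSphere.prod (.volumeIoiPow (Module.finrank ℝ (EuclideanSpace ℝ (Fin 3)) - 1))) := by
    rw [← hmp.integrable_comp_emb hemb]
    have : IntegrableOn f {0}ᶜ := hf.integrableOn
    rw [integrableOn_iff_comap_subtypeVal (by measurability)] at this
    refine this.congr (Filter.Eventually.of_forall fun x => (hcomp x).symm)
  rw [h1]
  simp_rw [← hcomp]
  rw [hmp.integral_comp hemb (fun q : Metric.sphere (0 : EuclideanSpace ℝ (Fin 3)) 1 × Set.Ioi (0:ℝ) => f ((q.2 : ℝ) • (q.1 : EuclideanSpace ℝ (Fin 3))))]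
  rw [integral_prod_symm _ hint]
  simp only [Measure.volumeIoiPow, ENNReal.ofReal, finrank_euclideanSpace, Fintype.card_fin]
  rw [integral_withDensity_eq_integral_smul (by fun_prop),
    integral_subtype_comap measurableSet_Ioi fun r ↦ Real.toNNReal (r ^ (3 - 1)) • ∫ ω : Metric.sphere (0 : EuclideanSpace ℝ (Fin 3)) 1,
      f (r • (ω : EuclideanSpace ℝ (Fin 3))) ∂((volume : Measure (EuclideanSpace ℝ (Fin 3))).toSphere)]
  refine setIntegral_congr_fun measurableSet_Ioi fun r hr => ?_
  simp only [NNReal.smul_def, smul_eq_mul]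
  rw [Real.coe_toNNReal _ (pow_nonneg (le_of_lt hr) _)]

lemma waveV_eq (p : EuclideanSpace ℝ (Fin 3)) (η : ℝ) (hη : 0 < η) (y : EuclideanSpace ℝ (Fin 3)) (t : ℝ)
    (hr : 0 < ‖y - p‖) (ht : 0 < t) (h1 : |‖y - p‖ - t| ≤ η) (h2 : η ≤ ‖y - p‖ + t) :
    waveV p η y t = (1 / (2 * ‖y - p‖)) *
      (η ^ 3 / 6 - η * (‖y - p‖ - t) ^ 2 / 2 + |‖y - p‖ - t| ^ 3 / 3) := by
  have hpsi : ∀ z, PsiB p η z = (fun s : ℝ => max (η - s) 0) ‖z - p‖ := by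
    intro z
    unfold PsiB
    split_ifs with h
    · exact (max_eq_left (by linarith)).symm
    · exact (max_eq_right (by linarith)).symm
  unfold waveV
  have e : ∀ ω : Metric.sphere (0 : EuclideanSpace ℝ (Fin 3)) 1, PsiB p η (y + t • (ω : EuclideanSpace ℝ (Fin 3)))
      = (fun s : ℝ => max (η - s) 0) ‖(y - p) + t • (ω : EuclideanSpace ℝ (Fin 3))‖ := by
    intro ω
    rw [hpsi]
    congr 2
    abel
  rw [integral_congr_ae (Filter.Eventually.of_forall e), sphere_int (y - p) hr t ht (fun s : ℝ => max (η - s) 0) (by fun_prop)]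
  set r := ‖y - p‖
  have hI : ∫ s in |r - t|..(r + t), max (η - s) 0 * s = η ^ 3 / 6 - η * (r - t) ^ 2 / 2 + |r - t| ^ 3 / 3 := by
    have hc : Continuous (fun s : ℝ => max (η - s) 0 * s) := by fun_prop
    rw [← intervalIntegral.integral_add_adjacent_intervals (b := η) (hc.intervalIntegrable _ _) (hc.intervalIntegrable _ _)]
    have i1 : ∫ s in |r - t|..η, max (η - s) 0 * s = ∫ s in |r - t|..η, (η * s - s ^ 2) := by
      refine intervalIntegral.integral_congr fun s hs => ?_
      rw [Set.uIcc_of_le h1] at hs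
      rw [max_eq_left (by linarith [hs.2])]
      ring
    have i2 : ∫ s in η..(r + t), max (η - s) 0 * s = ∫ s in η..(r + t), (0:ℝ) := by
      refine intervalIntegral.integral_congr fun s hs => ?_
      rw [Set.uIcc_of_le h2] at hs
      rw [max_eq_right (by linarith [hs.1])]
      ring
    rw [i1, i2, intervalIntegral.integral_sub (Continuous.intervalIntegrable (by fun_prop) _ _) (Continuous.intervalIntegrable (by fun_prop) _ _),
      intervalIntegral.integral_const_mul, integral_id, integral_pow, intervalIntegral.integral_zero]
    rw [sq_abs]
    push_cast
    ring
  rw [hI]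
  field_simp
  ring

lemma deriv_waveV (p : EuclideanSpace ℝ (Fin 3)) (η T : ℝ) (hη : 0 < η) (hT : η < T) (y : EuclideanSpace ℝ (Fin 3))
    (h1 : T - η < ‖y - p‖) (h2 : ‖y - p‖ < T + η) :
    deriv (fun s => waveV p η y s) T = (1 / (2 * ‖y - p‖)) *
      ((‖y - p‖ - T) * (η - |‖y - p‖ - T|)) := by
  have hr : 0 < ‖y - p‖ := by linarith
  have heq : (fun s => waveV p η y s) =ᶠ[nhds T] fun t => (1 / (2 * ‖y - p‖)) *
      (η ^ 3 / 6 - η * (‖y - p‖ - t) ^ 2 / 2 + |‖y - p‖ - t| ^ (3:ℝ) / 3) := by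
    have o : IsOpen {t : ℝ | |‖y - p‖ - t| < η ∧ η < ‖y - p‖ + t ∧ 0 < t} :=
by
      have o1 : IsOpen {t : ℝ | |‖y - p‖ - t| < η} := isOpen_lt (by fun_prop) (by fun_prop)
      have o2 : IsOpen {t : ℝ | η < ‖y - p‖ + t} := isOpen_lt (by fun_prop) (by fun_prop)
      have o3 : IsOpen {t : ℝ | 0 < t} := isOpen_lt (by fun_prop) (by fun_prop)
      exact o1.inter (o2.inter o3)
    have hm : T ∈ {t : ℝ | |‖y - p‖ - t| < η ∧ η < ‖y - p‖ + t ∧ 0 < t} := by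
      refine ⟨abs_lt.2 ⟨by linarith, by linarith⟩, by linarith, by linarith⟩
    filter_upwards [o.mem_nhds hm] with t ht
    rw [waveV_eq p η hη y t hr ht.2.2 ht.1.le ht.2.1.le]
    norm_cast
  rw [heq.deriv_eq]
  set r := ‖y - p‖
  apply HasDerivAt.deriv
  have d0 : HasDerivAt (fun t : ℝ => r - t) (-1) T := (hasDerivAt_id T).const_sub r
  have d1 := (hasDerivAt_abs_rpow (r - T) (p := 3) (by norm_num)).comp T d0
  have d2 := (((d0.pow 2).const_mul η).div_const 2).const_sub (η ^ 3 / 6)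
  have d3 := (d2.add (d1.div_const 3)).const_mul (1 / (2 * r))
  refine d3.congr_deriv ?_
  rw [show (3:ℝ) - 2 = 1 by norm_num, Real.rpow_one]
  push_cast
  ring

lemma polyexp (τ a b c0 c1 c2 c3 : ℝ) (hτ : 0 < τ) :
    ∫ r in a..b, (c0 + c1 * r + c2 * r ^ 2 + c3 * r ^ 3) * Real.exp (-τ * r) =
      (1 / τ) * (c0 * Hm1 τ a b + c1 * H0 τ a b + c2 * H1 τ a b + c3 * H2 τ a b) := by
  have hd : ∀ r ∈ Set.uIcc a b, HasDerivAt (fun r : ℝ => (-(1 / τ)) * ((c0 + c1 * (r + 1 / τ) + c2 * (r ^ 2 + 2 * r / τ + 2 / τ ^ 2)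
      + c3 * (r ^ 3 + 3 * r ^ 2 / τ + 6 * r / τ ^ 2 + 6 / τ ^ 3)) * Real.exp (-τ * r)))
      ((c0 + c1 * r + c2 * r ^ 2 + c3 * r ^ 3) * Real.exp (-τ * r)) r := by
    intro r _
    have x1 := hasDerivAt_id' r
    have x2 := hasDerivAt_pow 2 r
    have x3 := hasDerivAt_pow 3 r
    have E := (x1.const_mul (-τ)).exp
    have q1 := (x1.add_const (1 / τ)).const_mul c1
    have q2 := ((x2.add ((x1.const_mul 2).div_const τ)).add_const (2 / τ ^ 2)).const_mul c2
    have q3 := (((x3.add ((x2.const_mul 3).div_const τ)).add ((x1.const_mul 6).div_const (τ ^ 2))).add_const (6 / τ ^ 3)).const_mul c3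
    have := ((((q1.const_add c0).add q2).add q3).mul E).const_mul (-(1 / τ))
    refine this.congr_deriv ?_
    simp only [Pi.add_apply]
    field_simp
    push_cast
    ring
  rw [intervalIntegral.integral_eq_sub_of_hasDerivAt hd (Continuous.intervalIntegrable (by fun_prop) _ _)]
  unfold Hm1 H0 H1 H2
  ring

lemma final_int (τ T η : ℝ) (hτ : 0 < τ) (hη : 0 < η) :
    ∫ r in (T - η)..(T + η), (1 / 2) * (τ * (η ^ 3 / 6 - η * (r - T) ^ 2 / 2 + |r - T| ^ 3 / 3)
      - (r - T) * (η - |r - T|)) * Real.exp (-τ * r) = (1 / τ) * (Hplus τ T η + Hminus τ T η) := by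
  have hc : Continuous (fun r : ℝ => (1 / 2) * (τ * (η ^ 3 / 6 - η * (r - T) ^ 2 / 2 + |r - T| ^ 3 / 3)
      - (r - T) * (η - |r - T|)) * Real.exp (-τ * r)) := by fun_prop
  rw [← intervalIntegral.integral_add_adjacent_intervals (b := T) (hc.intervalIntegrable _ _) (hc.intervalIntegrable _ _)]
  have i1 : ∫ r in (T - η)..T, (1 / 2) * (τ * (η ^ 3 / 6 - η * (r - T) ^ 2 / 2 + |r - T| ^ 3 / 3)
      - (r - T) * (η - |r - T|)) * Real.exp (-τ * r) = ∫ r in (T - η)..T,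
      (((τ / 12) * (η + 2 * T) * (η - T) ^ 2 + (T / 2) * (η - T)) + ((τ / 2) * T * (η - T) - (η - 2 * T) / 2) * r
        + (-(τ / 4) * (η - 2 * T) - 1 / 2) * r ^ 2 + (-(τ / 6)) * r ^ 3) * Real.exp (-τ * r) := by
    refine intervalIntegral.integral_congr fun r hs => ?_
    rw [Set.uIcc_of_le (by linarith)] at hs
    rw [abs_of_nonpos (by linarith [hs.2])]
    ring
  have i2 : ∫ r in T..(T + η), (1 / 2) * (τ * (η ^ 3 / 6 - η * (r - T) ^ 2 / 2 + |r - T| ^ 3 / 3)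
      - (r - T) * (η - |r - T|)) * Real.exp (-τ * r) = ∫ r in T..(T + η),
      (((τ / 12) * (η - 2 * T) * (η + T) ^ 2 + (T / 2) * (η + T)) + ((τ / 2) * T * (η + T) - (η + 2 * T) / 2) * r
        + (-(τ / 4) * (η + 2 * T) + 1 / 2) * r ^ 2 + (τ / 6) * r ^ 3) * Real.exp (-τ * r) := by
    refine intervalIntegral.integral_congr fun r hs => ?_
    rw [Set.uIcc_of_le (by linarith)] at hs
    rw [abs_of_nonneg (by linarith [hs.1])]
    ring
  rw [i1, i2, polyexp _ _ _ _ _ _ _ hτ, polyexp _ _ _ _ _ _ _ hτ]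
  unfold Hplus Hminus
  ring

/-- The spherical mean of the Yukawa kernel. -/
lemma yukawa (τ r : ℝ) (hτ : 0 < τ) (ξ : EuclideanSpace ℝ (Fin 3)) (hξ : 0 < ‖ξ‖) (hr : ‖ξ‖ < r) :
    ∫ ω : Metric.sphere (0 : EuclideanSpace ℝ (Fin 3)) 1,
      Real.exp (-τ * ‖ξ - r • (ω : EuclideanSpace ℝ (Fin 3))‖) / ‖ξ - r • (ω : EuclideanSpace ℝ (Fin 3))‖
      ∂((volume : Measure (EuclideanSpace ℝ (Fin 3))).toSphere) =
    4 * π / (‖ξ‖ * r * τ) * (Real.exp (-τ * r) * Real.sinh (τ * ‖ξ‖)) := by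
  have h0 : 0 < r := hξ.trans hr
  have e : ∀ ω : Metric.sphere (0 : EuclideanSpace ℝ (Fin 3)) 1,
      Real.exp (-τ * ‖ξ - r • (ω : EuclideanSpace ℝ (Fin 3))‖) / ‖ξ - r • (ω : EuclideanSpace ℝ (Fin 3))‖
      = (fun s : ℝ => Real.exp (-τ * s) / s) ‖(-ξ) + r • (ω : EuclideanSpace ℝ (Fin 3))‖ := by
    intro ω
    simp only
    rw [← norm_neg, neg_sub, sub_eq_neg_add]
  have habs : |‖-ξ‖ - r| = r - ‖ξ‖ := by
    rw [norm_neg, abs_of_neg (by linarith)]; ring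
  rw [integral_congr_ae (Filter.Eventually.of_forall e), sphere_int (-ξ) (by simpa using hξ) r h0 (fun s : ℝ => Real.exp (-τ * s) / s)]
  · rw [habs, norm_neg]
    have i1 : ∫ s in (r - ‖ξ‖)..(‖ξ‖ + r), Real.exp (-τ * s) / s * s =
        ∫ s in (r - ‖ξ‖)..(‖ξ‖ + r), (1 + 0 * s + 0 * s ^ 2 + 0 * s ^ 3) * Real.exp (-τ * s) := by
      refine intervalIntegral.integral_congr fun s hs => ?_
      rw [Set.uIcc_of_le (by linarith)] at hs
      have : 0 < s := by linarith [hs.1]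
      field_simp
      ring
    rw [i1, polyexp _ _ _ _ _ _ _ hτ, Real.sinh_eq]
    have x1 : Real.exp (-τ * (r - ‖ξ‖)) = Real.exp (-τ * r) * Real.exp (τ * ‖ξ‖) := by
      rw [← Real.exp_add]; congr 1; ring
    have x2 : Real.exp (-τ * (‖ξ‖ + r)) = Real.exp (-τ * r) * Real.exp (-(τ * ‖ξ‖)) := by
      rw [← Real.exp_add]; congr 1; ring
    simp only [Hm1, x1, x2]
    field_simp
    ring
  · rw [habs]
    refine ContinuousOn.div (by fun_prop) (by fun_prop) ?_
    intro s hs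
    have : 0 < s := by linarith [hs.1]
    exact this.ne'

/-- Proposition 3.2. -/
theorem stmt_13 (p : EuclideanSpace ℝ (Fin 3)) (η T τ : ℝ)
    (hη : 0 < η) (hT : η < T) (hτ : 0 < τ)
    (x : EuclideanSpace ℝ (Fin 3)) (hx0 : 0 < ‖x - p‖) (hx : ‖x - p‖ < T - η) :
    (1 / (4 * π)) *
        ∫ y in {y : EuclideanSpace ℝ (Fin 3) | T - η < ‖y - p‖ ∧ ‖y - p‖ < T + η},
          Real.exp (-τ * ‖x - y‖) / ‖x - y‖ *
            (τ * waveV p η y T - deriv (fun s => waveV p η y s) T)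
      = (1 / τ ^ 2) * (Hplus τ T η + Hminus τ T η) *
          Real.sinh (τ * ‖x - p‖) / ‖x - p‖ := by
  have hTη : 0 < T - η := by linarith
  set S : Set (EuclideanSpace ℝ (Fin 3)) := {y | T - η < ‖y - p‖ ∧ ‖y - p‖ < T + η} with hS
  set ρ := ‖x - p‖ with hρ
  let W : ℝ → ℝ := fun r => (1 / (2 * r)) * (τ * (η ^ 3 / 6 - η * (r - T) ^ 2 / 2 + |r - T| ^ 3 / 3)
      - (r - T) * (η - |r - T|))
  let S0 : Set (EuclideanSpace ℝ (Fin 3)) := {z | T - η < ‖z‖ ∧ ‖z‖ < T + η}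
  have hSm : MeasurableSet S := by
    have o1 : IsOpen {y : EuclideanSpace ℝ (Fin 3) | T - η < ‖y - p‖} := isOpen_lt (by fun_prop) (by fun_prop)
    have o2 : IsOpen {y : EuclideanSpace ℝ (Fin 3) | ‖y - p‖ < T + η} := isOpen_lt (by fun_prop) (by fun_prop)
    exact (o1.inter o2).measurableSet
  have hS0o : IsOpen S0 := by
    have o1 : IsOpen {y : EuclideanSpace ℝ (Fin 3) | T - η < ‖y‖} := isOpen_lt (by fun_prop) (by fun_prop)
    have o2 : IsOpen {y : EuclideanSpace ℝ (Fin 3) | ‖y‖ < T + η} := isOpen_lt (by fun_prop) (by fun_prop)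
    exact o1.inter o2
  let K : EuclideanSpace ℝ (Fin 3) → ℝ := fun z =>
    Real.exp (-τ * ‖(x - p) - z‖) / ‖(x - p) - z‖ * W ‖z‖
  let f : EuclideanSpace ℝ (Fin 3) → ℝ := S0.indicator K
  have step1 : ∫ y in S, Real.exp (-τ * ‖x - y‖) / ‖x - y‖ *
      (τ * waveV p η y T - deriv (fun s => waveV p η y s) T) = ∫ z, f z := by
    rw [← integral_indicator hSm, ← integral_sub_right_eq_self f p]
    refine integral_congr_ae (Filter.Eventually.of_forall fun y => ?_)
    simp only
    by_cases hy : y ∈ S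
    · have hy0 : y - p ∈ S0 := hy
      rw [Set.indicator_of_mem hy]
      simp only [f]
      rw [Set.indicator_of_mem hy0]
      simp only [K, W]
      have hr : 0 < ‖y - p‖ := by linarith [hy.1]
      rw [deriv_waveV p η T hη hT y hy.1 hy.2, waveV_eq p η hη y T hr (by linarith)
        (abs_le.2 ⟨by linarith [hy.1], by linarith [hy.2]⟩) (by linarith), sub_sub_sub_cancel_right]
      ring
    · have hy0 : y - p ∉ S0 := hy
      simp only [f]
      rw [Set.indicator_of_notMem hy, Set.indicator_of_notMem hy0]
  have hfint : Integrable f := by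
    rw [integrable_indicator_iff hS0o.measurableSet]
    let C : Set (EuclideanSpace ℝ (Fin 3)) := {z | T - η ≤ ‖z‖} ∩ Metric.closedBall 0 (T + η)
    have hC : IsCompact C := (isCompact_closedBall _ _).inter_left (isClosed_le (by fun_prop) (by fun_prop))
    have hsub : S0 ⊆ C := fun z hz => ⟨hz.1.le, by simpa using hz.2.le⟩
    refine IntegrableOn.mono_set (ContinuousOn.integrableOn_compact hC ?_) hsub
    have hne : ∀ z ∈ C, ‖(x - p) - z‖ ≠ 0 := by
      intro z hz
      have h1 : T - η ≤ ‖z‖ := hz.1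
      have h2 := norm_sub_norm_le z (x - p)
      rw [norm_sub_rev z (x - p)] at h2
      have : 0 < ‖(x - p) - z‖ := by linarith
      exact this.ne'
    have hne2 : ∀ z ∈ C, 2 * ‖z‖ ≠ 0 := by
      intro z hz
      have h1 : T - η ≤ ‖z‖ := hz.1
      have : 0 < 2 * ‖z‖ := by linarith
      exact this.ne'
    refine ContinuousOn.mul (ContinuousOn.div (by fun_prop) (by fun_prop) hne) ?_
    exact ContinuousOn.mul (ContinuousOn.div (by fun_prop) (by fun_prop) hne2) (by fun_prop)
  rw [step1, polar_int f hfint]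
  have step2 : ∀ r ∈ Set.Ioi (0:ℝ), r ^ 2 * ∫ ω : Metric.sphere (0 : EuclideanSpace ℝ (Fin 3)) 1,
      f (r • (ω : EuclideanSpace ℝ (Fin 3))) ∂((volume : Measure (EuclideanSpace ℝ (Fin 3))).toSphere)
      = (Set.Ioo (T - η) (T + η)).indicator (fun r => (4 * π * Real.sinh (τ * ρ) / (ρ * τ)) *
        ((1 / 2) * (τ * (η ^ 3 / 6 - η * (r - T) ^ 2 / 2 + |r - T| ^ 3 / 3)
      - (r - T) * (η - |r - T|)) * Real.exp (-τ * r))) r := by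
    intro r hr
    have hr : 0 < r := hr
    have hn : ∀ ω : Metric.sphere (0 : EuclideanSpace ℝ (Fin 3)) 1, ‖r • (ω : EuclideanSpace ℝ (Fin 3))‖ = r := by
      intro ω
      rw [norm_smul, Real.norm_of_nonneg hr.le]; simp
    by_cases hm : r ∈ Set.Ioo (T - η) (T + η)
    · rw [Set.indicator_of_mem hm]
      have e : ∀ ω : Metric.sphere (0 : EuclideanSpace ℝ (Fin 3)) 1, f (r • (ω : EuclideanSpace ℝ (Fin 3))) =
          Real.exp (-τ * ‖(x - p) - r • (ω : EuclideanSpace ℝ (Fin 3))‖) / ‖(x - p) - r • (ω : EuclideanSpace ℝ (Fin 3))‖ * W r := by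
        intro ω
        have : r • (ω : EuclideanSpace ℝ (Fin 3)) ∈ S0 := by
          change _ < _ ∧ _ < _
          rw [hn]; exact hm
        simp only [f]
        rw [Set.indicator_of_mem this]
        simp only [K]
        rw [hn]
      rw [integral_congr_ae (Filter.Eventually.of_forall e), integral_mul_const, yukawa τ r hτ (x - p) hx0 (by linarith [hm.1])]
      simp only [W]
      rw [← hρ]
      field_simp
    · rw [Set.indicator_of_notMem hm]
      have e : ∀ ω : Metric.sphere (0 : EuclideanSpace ℝ (Fin 3)) 1, f (r • (ω : EuclideanSpace ℝ (Fin 3))) = 0 := by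
        intro ω
        have : r • (ω : EuclideanSpace ℝ (Fin 3)) ∉ S0 := by
          intro h
          have h : _ < _ ∧ _ < _ := h
          rw [hn] at h; exact hm h
        simp only [f]
        rw [Set.indicator_of_notMem this]
      simp [e]
  rw [setIntegral_congr_fun measurableSet_Ioi step2, integral_indicator measurableSet_Ioo,
    Measure.restrict_restrict measurableSet_Ioo,
    show Set.Ioo (T - η) (T + η) ∩ Set.Ioi 0 = Set.Ioo (T - η) (T + η) from Set.inter_eq_left.2 (fun r hr => hTη.trans hr.1), integral_const_mul]
  rw [← integral_Ioc_eq_integral_Ioo, ← intervalIntegral.integral_of_le (by linarith), final_int τ T η hτ hη]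
  field_simp
end

section
/- (Lemma 2.3 (ii), convex version.) Let U ⊂ ℝ³ be a nonempty bounded open convex set, p ∈ ℝ³, and R_U(p) = sup_{x ∈ U} |x − p|. There exist a real number μ₂, constants C > 0 and τ₀ > 0 such that for all τ ≥ τ₀, τ^{2μ₂} e^{−2τ R_U(p)} ∫_U ( sinh(τ|x − p|)/|x − p| )² dx ≥ C. -/
open MeasureTheory Real

lemma aux_int (U : Set (EuclideanSpace ℝ (Fin 3)))
    (hUo : IsOpen U) (hfin : volume U ≠ ⊤)
    (p : EuclideanSpace ℝ (Fin 3)) (R τ : ℝ) (hτ : 0 < τ) (hR : ∀ x ∈ U, ‖x - p‖ ≤ R) :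
    IntegrableOn (fun x => (Real.sinh (τ * ‖x - p‖) / ‖x - p‖) ^ 2) U := by
  refine IntegrableOn.of_bound (lt_top_iff_ne_top.2 hfin) ?_ ((τ * Real.exp (τ * R)) ^ 2) ?_
  · apply Measurable.aestronglyMeasurable
    have h1 : Measurable (fun x : EuclideanSpace ℝ (Fin 3) => ‖x - p‖) := by fun_prop
    exact ((Real.measurable_sinh.comp (h1.const_mul τ)).div h1).pow_const 2
  · filter_upwards [ae_restrict_mem hUo.measurableSet] with x hx
    have hn := norm_nonneg (x - p)
    have hle := hR x hx
    generalize ‖x - p‖ = n at hn hle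
    have hs : 0 ≤ Real.sinh (τ * n) := Real.sinh_nonneg_iff.2 (by positivity)
    rw [Real.norm_of_nonneg (by positivity)]
    have hb : Real.sinh (τ * n) ≤ τ * n * Real.exp (τ * n) := by
      rw [Real.sinh_eq]
      have h1 := Real.add_one_le_exp (-(2 * (τ * n)))
      have h2 : Real.exp (-(τ * n)) = Real.exp (τ * n) * Real.exp (-(2 * (τ * n))) := by
        rw [← Real.exp_add]; congr 1; ring
      rw [h2]
      nlinarith [Real.exp_pos (τ * n)]
    have he : Real.exp (τ * n) ≤ Real.exp (τ * R) := by gcongr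
    gcongr
    rcases hn.eq_or_lt with h | h
    · rw [← h]; simp; positivity
    · rw [div_le_iff₀ h]
      nlinarith [mul_le_mul_of_nonneg_left he (by positivity : 0 ≤ τ * n)]

/-- Lemma 2.3 (ii), convex version. -/
theorem stmt_18 (U : Set (EuclideanSpace ℝ (Fin 3))) (hUne : U.Nonempty)
    (hUb : Bornology.IsBounded U) (hUo : IsOpen U) (hUc : Convex ℝ U)
    (p : EuclideanSpace ℝ (Fin 3)) :
    ∃ (μ₂ : ℝ) (C : ℝ) (τ₀ : ℝ), 0 < C ∧ 0 < τ₀ ∧ ∀ τ ≥ τ₀,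
      C ≤ τ ^ (2 * μ₂) * Real.exp (-2 * τ * sSup ((fun x => ‖x - p‖) '' U)) *
            ∫ x in U, (Real.sinh (τ * ‖x - p‖) / ‖x - p‖) ^ 2 := by
  have hbdd : BddAbove ((fun x => ‖x - p‖) '' U) := by
    obtain ⟨M, hM⟩ := hUb.subset_closedBall p
    refine ⟨M, ?_⟩
    rintro _ ⟨x, hx, rfl⟩
    simpa [dist_eq_norm] using hM hx
  have hRle : ∀ x ∈ U, ‖x - p‖ ≤ sSup ((fun x => ‖x - p‖) '' U) := fun x hx =>
    le_csSup hbdd ⟨x, hx, rfl⟩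
  have hlt : ∀ s < sSup ((fun x => ‖x - p‖) '' U), ∃ y ∈ U, s < ‖y - p‖ := by
    intro s hs
    obtain ⟨_, ⟨y, hy, rfl⟩, h⟩ := exists_lt_of_lt_csSup (hUne.image _) hs
    exact ⟨y, hy, h⟩
  have hfin : volume U ≠ ⊤ := hUb.measure_lt_top.ne
  generalize sSup ((fun x => ‖x - p‖) '' U) = R at hRle hlt
  obtain ⟨a, ha⟩ := hUne
  obtain ⟨r, hr, hball⟩ := Metric.isOpen_iff.1 hUo a ha
  have hRpos : 0 < R := by
    by_contra hneg
    have hsub : U ⊆ {p} := fun x hx => by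
      have := hRle x hx
      have h0 : ‖x - p‖ = 0 := le_antisymm (by linarith) (norm_nonneg _)
      simpa [sub_eq_zero] using h0
    have h1 := hUo.measure_pos volume ⟨a, ha⟩
    have h2 : volume U ≤ 0 := by
      simpa using measure_mono (μ := volume) hsub
    exact absurd h1 (not_lt.2 h2)
  set K : ℝ := 2 * R + r + 1 with hK
  set V : ℝ := volume.real (Metric.ball (0 : EuclideanSpace ℝ (Fin 3)) 1) with hV
  have hVpos : 0 < V := by
    apply ENNReal.toReal_pos
    · exact (Metric.measure_ball_pos volume _ one_pos).ne'
    · exact measure_ball_lt_top.ne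
  refine ⟨3 / 2, r ^ 3 * V * (Real.exp (-K) / (4 * R)) ^ 2, max 1 ((K + 1) / R), by positivity,
    by positivity, ?_⟩
  intro τ hτ
  have hτ1 : 1 ≤ τ := le_trans (le_max_left _ _) hτ
  have hτK : K + 1 ≤ τ * R := (div_le_iff₀ hRpos).1 (le_trans (le_max_right _ _) hτ)
  have hτ0 : 0 < τ := by linarith
  have ht0 : 0 < 1 / τ := by positivity
  have ht1 : 1 / τ ≤ 1 := (div_le_one hτ0).2 hτ1
  have htτ : 1 / τ * τ = 1 := by field_simp
  set t := 1 / τ with ht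
  obtain ⟨y, hy, hyR⟩ := hlt (R - t) (by linarith)
  set c := y + t • (a - y) with hc
  set B := Metric.ball c (t * r) with hB
  have hBU : B ⊆ U := by
    intro x hx
    have hz : a + τ • (x - c) ∈ U := by
      apply hball
      rw [hB, Metric.mem_ball, dist_eq_norm] at hx
      rw [Metric.mem_ball, dist_eq_norm, add_sub_cancel_left, norm_smul,
        Real.norm_of_nonneg hτ0.le]
      calc τ * ‖x - c‖ < τ * (t * r) := by gcongr
        _ = r := by rw [← mul_assoc, mul_comm τ, htτ, one_mul]
    have := hUc hy hz (by linarith : 0 ≤ 1 - t) ht0.le (by ring)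
    convert this using 1
    rw [smul_add, smul_smul, htτ, hc]
    module
  have hlow : ∀ x ∈ B, R - t * K ≤ ‖x - p‖ := by
    intro x hx
    rw [hB, Metric.mem_ball, dist_eq_norm] at hx
    have e1 : y - p = (x - p) - (x - c) - t • ((a - p) - (y - p)) := by rw [hc]; module
    have e2 : ‖y - p‖ ≤ ‖x - p‖ + ‖x - c‖ + t * (‖a - p‖ + ‖y - p‖) := by
      calc ‖y - p‖ = ‖(x - p) - (x - c) - t • ((a - p) - (y - p))‖ := by rw [← e1]
        _ ≤ ‖(x - p) - (x - c)‖ + ‖t • ((a - p) - (y - p))‖ := norm_sub_le _ _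
        _ ≤ _ := by
          rw [norm_smul, Real.norm_of_nonneg ht0.le]
          gcongr
          · exact norm_sub_le _ _
          · exact norm_sub_le _ _
    have e3 : t * (‖a - p‖ + ‖y - p‖) ≤ t * (R + R) := by
      gcongr
      · exact hRle a ha
      · exact hRle y hy
    rw [hK]; linarith
  have hpt : ∀ x ∈ B, (Real.exp (τ * R) * (Real.exp (-K) / (4 * R))) ^ 2 ≤
      (Real.sinh (τ * ‖x - p‖) / ‖x - p‖) ^ 2 := by
    intro x hx
    have h1 := hlow x hx
    have h2 := hRle x (hBU hx)
    have hn := norm_nonneg (x - p)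
    generalize ‖x - p‖ = n at h1 h2 hn
    have h3 : τ * R - K ≤ τ * n := by
      have := mul_le_mul_of_nonneg_left h1 hτ0.le
      have h4 : τ * (R - t * K) = τ * R - (t * τ) * K := by ring
      rw [h4, htτ] at this; linarith
    have h5 : 1 ≤ τ * n := by linarith
    have hnpos : 0 < n := by
      by_contra h
      have : n = 0 := by linarith
      subst this; simp at h5; linarith
    have h6 : Real.exp (τ * n) / 4 ≤ Real.sinh (τ * n) := by
      rw [Real.sinh_eq, Real.exp_neg]
      have := Real.add_one_le_exp (τ * n)
      have h7 : (Real.exp (τ * n))⁻¹ ≤ 2⁻¹ := by gcongr; linarith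
      linarith
    have h8 : Real.exp (τ * R) * Real.exp (-K) ≤ Real.exp (τ * n) := by
      rw [← Real.exp_add]; gcongr; linarith
    gcongr
    calc _ = (Real.exp (τ * R) * Real.exp (-K)) / 4 / R := by field_simp
      _ ≤ (Real.exp (τ * n)) / 4 / n := by gcongr
      _ ≤ _ := by gcongr
  have hint := aux_int U hUo hfin p R τ hτ0 hRle
  have hvol : volume.real B = t ^ 3 * r ^ 3 * V := by
    rw [hB, hV, Measure.real, Measure.real, Measure.addHaar_ball _ _ (by positivity),
      ENNReal.toReal_mul, ENNReal.toReal_ofReal (by positivity)]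
    simp [mul_pow]
  have hI : (Real.exp (τ * R) * (Real.exp (-K) / (4 * R))) ^ 2 * (t ^ 3 * r ^ 3 * V) ≤
      ∫ x in U, (Real.sinh (τ * ‖x - p‖) / ‖x - p‖) ^ 2 := by
    calc _ ≤ ∫ x in B, (Real.sinh (τ * ‖x - p‖) / ‖x - p‖) ^ 2 := by
          rw [← hvol]
          exact setIntegral_ge_of_const_le_real measurableSet_ball measure_ball_lt_top.ne hpt
            (hint.mono_set hBU)
      _ ≤ _ := setIntegral_mono_set hint (Filter.Eventually.of_forall fun x => sq_nonneg _)
          hBU.eventuallyLE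
  have hpow : τ ^ (2 * (3 / 2 : ℝ)) = τ ^ 3 := by
    rw [← Real.rpow_natCast]; norm_num
  rw [hpow]
  have hexp : Real.exp (-2 * τ * R) * Real.exp (τ * R) ^ 2 = 1 := by
    rw [sq, ← Real.exp_add, ← Real.exp_add, Real.exp_eq_one_iff]; ring
  calc r ^ 3 * V * (Real.exp (-K) / (4 * R)) ^ 2
      = (t * τ) ^ 3 * (Real.exp (-2 * τ * R) * Real.exp (τ * R) ^ 2) *
        (r ^ 3 * V * (Real.exp (-K) / (4 * R)) ^ 2) := by rw [htτ, hexp]; ring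
    _ = τ ^ 3 * Real.exp (-2 * τ * R) *
      ((Real.exp (τ * R) * (Real.exp (-K) / (4 * R))) ^ 2 * (t ^ 3 * r ^ 3 * V)) := by ring
    _ ≤ _ := by gcongr
end
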